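/- If (μ, ν) is a regular pair of standard Weyl pairs, then the Clebsch–Gordan space V_{(μ,ν)} is a subspace of Hom(ℂ^N, ℂ^N ⊗ ℂ^N) of dimension exactly N. -/

import Mathlib

open TensorProduct

noncomputable section

/-- ℂ^N: functions from ℤ/Nℤ to ℂ. -/
abbrev CN (N : ℕ) := ZMod N → ℂ

/-- The operator A with A e_k = q^{2k} e_k. -/
def opA (q : ℂ) (N : ℕ) : Module.End ℂ (CN N) where
  toFun f := fun k => q ^ (2 * k.val) * f k
  map_add' f g := by funext k; simp [mul_add]
  map_smul' c f := by funext k; simp [smul_eq_mul]; ring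

/-- The operator B with B e_k = e_{k+1}. -/
def opB (N : ℕ) : Module.End ℂ (CN N) where
  toFun f := fun k => f (k - 1)
  map_add' f g := by funext k; simp
  map_smul' c f := by funext k; simp

/-- The operator C with C e_k = q^{1-2k} e_{k-1}, i.e. (C f)(k) = q^{-1-2k} f(k+1). -/
def opC (q : ℂ) (N : ℕ) : Module.End ℂ (CN N) where
  toFun f := fun k => q ^ (-1 - 2 * (k.val : ℤ)) * f (k + 1)
  map_add' f g := by funext k; simp [mul_add]
  map_smul' c f := by funext k; simp [smul_eq_mul]; ring

/-- A Weyl pair: invertible endomorphisms with X Y = q² Y X. -/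
def IsWeylPair (q : ℂ) {V : Type*} [AddCommMonoid V] [Module ℂ V]
    (X Y : Module.End ℂ V) : Prop :=
  IsUnit X ∧ IsUnit Y ∧ X * Y = q ^ 2 • (Y * X)

/-- A subspace invariant under both X and Y. -/
def WeylInvariant {V : Type*} [AddCommMonoid V] [Module ℂ V]
    (X Y : Module.End ℂ V) (W : Submodule ℂ V) : Prop :=
  (∀ v ∈ W, X v ∈ W) ∧ (∀ v ∈ W, Y v ∈ W)

/-- An irreducible Weyl pair. -/
def IsIrreducibleWeylPair (q : ℂ) {V : Type*} [AddCommMonoid V] [Module ℂ V]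
    (X Y : Module.End ℂ V) : Prop :=
  IsWeylPair q X Y ∧ Nontrivial V ∧
    ∀ W : Submodule ℂ V, WeylInvariant X Y W → W = ⊥ ∨ W = ⊤
/-- The Clebsch–Gordan space of a pair of Weyl pairs: all linear maps
f : ℂ^N → ℂ^N ⊗ ℂ^N with f∘X_{αβ} = (X_α⊗X_β)∘f and
f∘Y_{αβ} = (X_α⁻¹⊗Y_β + Y_α⊗Id)∘f. -/
def CGsub (N : ℕ) (Xa Ya Xb Yb Xab Yab : Module.End ℂ (CN N)) :
    Submodule ℂ (CN N →ₗ[ℂ] (CN N ⊗[ℂ] CN N)) where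
  carrier := {f | f ∘ₗ Xab = (TensorProduct.map Xa Xb) ∘ₗ f ∧
    f ∘ₗ Yab = (TensorProduct.map (Ring.inverse Xa) Yb + TensorProduct.map Ya 1) ∘ₗ f}
  add_mem' := by
    rintro f g ⟨hf1, hf2⟩ ⟨hg1, hg2⟩
    constructor <;> simp only [LinearMap.add_comp, LinearMap.comp_add, hf1, hf2, hg1, hg2]
  zero_mem' := by constructor <;> simp
  smul_mem' := by
    rintro c f ⟨hf1, hf2⟩
    constructor <;> simp only [LinearMap.smul_comp, LinearMap.comp_smul, hf1, hf2]


open Polynomial in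
lemma prod_root_aux {N : ℕ} (hN : 1 ≤ N) {ζ : ℂ} (h : IsPrimitiveRoot ζ N) (b : ℂ) :
    ∏ j ∈ Finset.range N, (C b + C (ζ ^ j) * X : ℂ[X]) = (C b) ^ N - (-X) ^ N := by
  have : NeZero N := ⟨by omega⟩
  have h' : IsPrimitiveRoot (C ζ : ℂ[X]) N := h.map_of_injective C_injective
  rw [h'.pow_sub_pow_eq_prod_sub_mul (C b) (-X) (by omega)]
  refine Finset.prod_nbij (fun j => (C ζ) ^ j) ?_ ?_ ?_ ?_
  · intro j _
    rw [mem_nthRootsFinset (by omega), ← pow_mul, mul_comm, pow_mul, h'.pow_eq_one, one_pow]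
  · intro i hi j hj hij
    exact h'.pow_inj (by simpa using hi) (by simpa using hj) hij
  · intro x hx
    rw [Finset.mem_coe, mem_nthRootsFinset (by omega)] at hx
    obtain ⟨i, hi, rfl⟩ := h'.eq_pow_of_pow_eq_one hx
    exact ⟨i, by simpa using hi, rfl⟩
  · intro j _
    simp

open Polynomial in
lemma qpow_aux {A : Type*} [Ring A] [Algebra ℂ A] (ζ : ℂ) (R Q : A)
    (h : Q * R = ζ • (R * Q)) (b : ℂ) (n : ℕ) :
    (R * Q + b • Q) ^ n =
      aeval R (∏ j ∈ Finset.range n, (C b + C (ζ ^ j) * X : ℂ[X])) * Q ^ n := by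
  have hQ : ∀ n : ℕ, Q ^ n * R = ζ ^ n • (R * Q ^ n) := by
    intro n
    induction n with
    | zero => simp
    | succ n ih =>
      rw [pow_succ, mul_assoc, h, mul_smul_comm, ← mul_assoc, ih, smul_mul_assoc, smul_smul,
        mul_assoc, ← pow_succ']
  induction n with
  | zero => simp
  | succ n ih =>
    rw [pow_succ, ih, Finset.prod_range_succ, map_mul, mul_assoc, mul_assoc]
    congr 1
    simp only [map_add, map_mul, aeval_C, aeval_X, Algebra.algebraMap_eq_smul_one]
    rw [mul_add, ← mul_assoc, hQ, add_mul, mul_smul_comm, ← pow_succ]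
    simp only [smul_mul_assoc, one_mul, mul_assoc, ← pow_succ]
    rw [add_comm]

lemma qbinom_aux {A : Type*} [Ring A] [Algebra ℂ A] {N : ℕ} (hN : 1 ≤ N) {ζ : ℂ}
    (hz : IsPrimitiveRoot ζ N) (P Q : A) (hQ : IsUnit Q) (h : Q * P = ζ • (P * Q)) :
    (P + Q) ^ N = P ^ N + Q ^ N := by
  obtain ⟨Qu, rfl⟩ := hQ
  set R : A := P * (Qu⁻¹ : Aˣ) with hR
  have hRQ : R * Qu = P := by simp [hR]
  have hc : (Qu : A) * R = ζ • (R * Qu) := by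
    rw [hRQ, hR, ← mul_assoc, h]; simp [mul_assoc]
  have h1 := qpow_aux ζ R Qu hc 1 N
  have h0 := qpow_aux ζ R Qu hc 0 N
  rw [prod_root_aux hN hz] at h1 h0
  rw [hRQ] at h1 h0
  have : N ≠ 0 := by omega
  simp only [one_smul, zero_smul, add_zero] at h1 h0
  rw [h1, h0]
  simp [this, sub_mul]
  abel

section ops
variable {N : ℕ} {q : ℂ}

lemma chi_add [NeZero N] (hq : (q ^ 2) ^ N = 1) (i j : ZMod N) :
    (q ^ 2) ^ (i + j).val = (q ^ 2) ^ i.val * (q ^ 2) ^ j.val := by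
  rw [ZMod.val_add, ← pow_eq_pow_mod _ hq, pow_add]

lemma chi_one (hq : (q ^ 2) ^ N = 1) : (q ^ 2) ^ (1 : ZMod N).val = q ^ 2 := by
  rw [ZMod.val_one_eq_one_mod, ← pow_eq_pow_mod _ hq, pow_one]

lemma opA_apply (f : CN N) (k : ZMod N) : opA q N f k = (q ^ 2) ^ k.val * f k := by
  simp [opA, pow_mul]

lemma opB_apply (f : CN N) (k : ZMod N) : opB N f k = f (k - 1) := rfl

lemma opA_pow (hq : (q ^ 2) ^ N = 1) : opA q N ^ N = 1 := by
  have : ∀ n : ℕ, ∀ f k, (opA q N ^ n) f k = ((q ^ 2) ^ k.val) ^ n * f k := by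
    intro n
    induction n with
    | zero => simp
    | succ n ih => intro f k; rw [pow_succ, Module.End.mul_apply, ih, opA_apply]; ring
  refine LinearMap.ext fun f => funext fun k => ?_
  rw [this, ← pow_mul, mul_comm, mul_comm k.val, pow_mul, hq]; simp

lemma opB_pow : opB N ^ N = 1 := by
  have : ∀ n : ℕ, ∀ f k, (opB N ^ n) f k = f (k - n) := by
    intro n
    induction n with
    | zero => simp
    | succ n ih =>
      intro f k; rw [pow_succ, Module.End.mul_apply, ih, opB_apply]; push_cast; congr 1; ring
  refine LinearMap.ext fun f => funext fun k => ?_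
  rw [this]; simp

lemma opAB [NeZero N] (hq : (q ^ 2) ^ N = 1) : opA q N * opB N = q ^ 2 • (opB N * opA q N) := by
  refine LinearMap.ext fun f => funext fun k => ?_
  simp only [Module.End.mul_apply, LinearMap.smul_apply, Pi.smul_apply, smul_eq_mul, opA_apply,
    opB_apply]
  have := chi_add hq (k - 1) 1
  rw [sub_add_cancel, chi_one hq] at this
  rw [this]; ring

lemma opA_single (k : ZMod N) :
    opA q N (Pi.single k 1) = (q ^ 2) ^ k.val • (Pi.single k 1 : CN N) := by
  funext j
  rw [opA_apply]
  by_cases h : j = k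
  · subst h; simp
  · simp [h]

lemma opB_single (k : ZMod N) : opB N (Pi.single k 1) = (Pi.single (k + 1) 1 : CN N) := by
  funext j
  rw [opB_apply]
  simp [Pi.single_apply, sub_eq_iff_eq_add]

end ops

section tens
variable {N : ℕ} {q : ℂ} {u v u' v' : ℂ}

lemma inv_facts (hN : 1 ≤ N) (hq : (q ^ 2) ^ N = 1) (hu : u ≠ 0) :
    ∃ I : Module.End ℂ (CN N), Ring.inverse (u • opA q N) = I ∧ (u • opA q N) * I = 1 ∧
      I * (u • opA q N) = 1 ∧ I ^ N = (u ^ N)⁻¹ • 1 ∧ opB N * I = q ^ 2 • (I * opB N) := by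
  have : NeZero N := ⟨by omega⟩
  have hA : IsUnit (u • opA q N) := by
    have h1 : IsUnit (opA q N) := IsUnit.of_pow_eq_one (opA_pow hq) (by omega)
    have := h1.smul (Units.mk0 u hu)
    exact this
  refine ⟨_, rfl, Ring.mul_inverse_cancel _ hA, Ring.inverse_mul_cancel _ hA, ?_, ?_⟩
  · have hc : Commute (u • opA q N) (Ring.inverse (u • opA q N)) := by
      rw [Commute, SemiconjBy, Ring.mul_inverse_cancel _ hA, Ring.inverse_mul_cancel _ hA]
    have := hc.mul_pow N
    rw [Ring.mul_inverse_cancel _ hA, smul_pow, opA_pow hq, one_pow, smul_one_mul] at this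
    rw [this, smul_smul, inv_mul_cancel₀ (pow_ne_zero _ hu), one_smul]
  · generalize hI : Ring.inverse (u • opA q N) = I
    have h1 : (u • opA q N) * I = 1 := hI ▸ Ring.mul_inverse_cancel _ hA
    have h2 : I * (u • opA q N) = 1 := hI ▸ Ring.inverse_mul_cancel _ hA
    have h3 : (u • opA q N) * opB N = q ^ 2 • (opB N * (u • opA q N)) := by
      rw [smul_mul_assoc, opAB hq, mul_smul_comm, smul_comm]
    calc opB N * I = I * ((u • opA q N) * opB N) * I := by rw [← mul_assoc I, h2, one_mul]
      _ = q ^ 2 • (I * opB N * ((u • opA q N) * I)) := by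
        rw [h3]; simp only [mul_smul_comm, smul_mul_assoc, mul_assoc]
      _ = _ := by rw [h1, mul_one]

lemma Y_facts (hN : 1 ≤ N) (hq : IsPrimitiveRoot (q ^ 2) N) (hu : u ≠ 0) (hv : v ≠ 0) :
    (TensorProduct.map (Ring.inverse (u • opA q N)) (v' • opB N) +
      TensorProduct.map (v • opB N) 1 : Module.End ℂ (CN N ⊗[ℂ] CN N)) ^ N =
      ((u ^ N)⁻¹ * v' ^ N + v ^ N) • 1 ∧
    (TensorProduct.map (u • opA q N) (u' • opA q N) : Module.End ℂ (CN N ⊗[ℂ] CN N)) *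
      (TensorProduct.map (Ring.inverse (u • opA q N)) (v' • opB N) +
      TensorProduct.map (v • opB N) 1) = q ^ 2 •
      ((TensorProduct.map (Ring.inverse (u • opA q N)) (v' • opB N) +
      TensorProduct.map (v • opB N) 1) * TensorProduct.map (u • opA q N) (u' • opA q N)) := by
  have : NeZero N := ⟨by omega⟩
  obtain ⟨I, hI, h1, h2, h3, h4⟩ := inv_facts (N := N) hN hq.pow_eq_one hu
  rw [hI]
  constructor
  · have hQN : (TensorProduct.map (v • opB N) 1 : Module.End ℂ (CN N ⊗[ℂ] CN N)) ^ N
        = v ^ N • 1 := by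
      rw [TensorProduct.map_pow, smul_pow, opB_pow, one_pow, TensorProduct.map_smul_left,
        TensorProduct.map_one]
    refine (qbinom_aux (A := Module.End ℂ (CN N ⊗[ℂ] CN N)) hN hq _ _ ?_ ?_).trans ?_
    · have : IsUnit ((TensorProduct.map (v • opB N) 1 : Module.End ℂ (CN N ⊗[ℂ] CN N)) ^ N) := by
        rw [hQN]
        exact (isUnit_one (M := Module.End ℂ (CN N ⊗[ℂ] CN N))).smul
          (Units.mk0 (v ^ N) (pow_ne_zero _ hv))
      exact (isUnit_pow_iff (by omega)).1 this
    · rw [← TensorProduct.map_mul, ← TensorProduct.map_mul, one_mul, mul_one, smul_mul_assoc, h4,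
        mul_smul_comm, smul_comm, TensorProduct.map_smul_left]
    · rw [add_smul]
      refine congrArg₂ _ ?_ hQN
      rw [TensorProduct.map_pow, h3, smul_pow, opB_pow,
        TensorProduct.map_smul_left, TensorProduct.map_smul_right, TensorProduct.map_one, smul_smul]
  · have hX : opA q N * opB N = q ^ 2 • (opB N * opA q N) := opAB hq.pow_eq_one
    rw [mul_add, add_mul, smul_add]
    simp only [← TensorProduct.map_mul, h1, h2, one_mul, mul_one]
    simp only [smul_mul_assoc, mul_smul_comm, hX, TensorProduct.map_smul_left,
      TensorProduct.map_smul_right]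
    congr 1
    · module
    · module

end tens

lemma CG_construct {N : ℕ} [NeZero N] {q u'' v'' : ℂ} (hq : (q ^ 2) ^ N = 1) (hv'' : v'' ≠ 0)
    {T : Type*} [AddCommGroup T] [Module ℂ T] (X Y : Module.End ℂ T)
    (hY : Y ^ N = v'' ^ N • 1) (hXY : X * Y = q ^ 2 • (Y * X)) (w : T) (hw : X w = u'' • w) :
    ∃ f : CN N →ₗ[ℂ] T, f ∘ₗ (u'' • opA q N) = X ∘ₗ f ∧ f ∘ₗ (v'' • opB N) = Y ∘ₗ f ∧
      f (Pi.single 0 1) = w := by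
  let g : ℕ → T := fun n => (v''⁻¹ ^ n) • (Y ^ n) w
  have hgN : ∀ n, g (n + N) = g n := by
    intro n
    simp only [g]
    rw [pow_add Y, hY, mul_smul_one, LinearMap.smul_apply, smul_smul, pow_add, mul_assoc,
      ← mul_pow, inv_mul_cancel₀ hv'', one_pow, mul_one]
  have hgm : ∀ n, g (n % N) = g n := fun n => (Function.Periodic.map_mod_nat hgN n)
  have hgX : ∀ n, X (g n) = ((q ^ 2) ^ n * u'') • g n := by
    intro n
    have : ∀ n, X ((Y ^ n) w) = ((q ^ 2) ^ n * u'') • (Y ^ n) w := by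
      intro n
      induction n with
      | zero => simp [hw]
      | succ n ih =>
        rw [pow_succ', Module.End.mul_apply, ← Module.End.mul_apply, hXY, LinearMap.smul_apply,
          Module.End.mul_apply, ih, map_smul, smul_smul]
        congr 1; ring
    simp only [g, map_smul, this]
    rw [smul_comm]
  have hgY : ∀ n, Y (g n) = v'' • g (n + 1) := by
    intro n
    simp only [g, map_smul]
    rw [pow_succ' Y, Module.End.mul_apply, smul_smul, pow_succ', ← mul_assoc,
      mul_inv_cancel₀ hv'', one_mul]
  let f : CN N →ₗ[ℂ] T := (Pi.basisFun ℂ (ZMod N)).constr ℂ (fun k => g k.val)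
  have hf : ∀ k, f (Pi.single k 1) = g k.val := by
    intro k
    have := (Pi.basisFun ℂ (ZMod N)).constr_basis ℂ (fun k => g k.val) k
    rwa [Pi.basisFun_apply] at this
  refine ⟨f, ?_, ?_, ?_⟩
  · refine (Pi.basisFun ℂ (ZMod N)).ext fun k => ?_
    rw [Pi.basisFun_apply]
    simp only [LinearMap.comp_apply, LinearMap.smul_apply, opA_single, map_smul, hf, hgX]
    rw [smul_smul, mul_comm]
  · refine (Pi.basisFun ℂ (ZMod N)).ext fun k => ?_
    rw [Pi.basisFun_apply]
    simp only [LinearMap.comp_apply, LinearMap.smul_apply, opB_single, map_smul, hf, hgY]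
    rw [ZMod.val_add, hgm, ZMod.val_one_eq_one_mod, ← hgm, Nat.add_mod_mod, hgm]
  · rw [hf]; simp [g]

lemma CG_eq {N : ℕ} [NeZero N] {v'' : ℂ} (hv'' : v'' ≠ 0)
    {T : Type*} [AddCommMonoid T] [Module ℂ T] (Y : Module.End ℂ T)
    (f g : CN N →ₗ[ℂ] T) (h : f ∘ₗ (v'' • opB N) = Y ∘ₗ f) (h' : g ∘ₗ (v'' • opB N) = Y ∘ₗ g)
    (h0 : f (Pi.single 0 1) = g (Pi.single 0 1)) :
    f = g := by
  have key : ∀ n : ℕ, f (Pi.single (n : ZMod N) 1) = g (Pi.single (n : ZMod N) 1) := by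
    intro n
    induction n with
    | zero => simpa using h0
    | succ n ih =>
      have h1 := LinearMap.congr_fun h (Pi.single (n : ZMod N) 1)
      have h2 := LinearMap.congr_fun h' (Pi.single (n : ZMod N) 1)
      simp only [LinearMap.comp_apply, LinearMap.smul_apply, opB_single, map_smul] at h1 h2
      rw [ih, ← h2] at h1
      push_cast
      exact (IsUnit.mk0 _ hv'').smul_left_cancel.1 h1
  refine (Pi.basisFun ℂ (ZMod N)).ext fun k => ?_
  rw [Pi.basisFun_apply, ← ZMod.natCast_zmod_val k]
  exact key _

/-- for a regular pair (μ, ν) of standard Weyl pairs, the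
Clebsch–Gordan space V_{(μ,ν)} has dimension exactly N. -/
theorem stmt6 (N : ℕ) (hN : 1 ≤ N) (q : ℂ) (hq : IsPrimitiveRoot (q ^ 2) N)
    (u v u' v' u'' v'' : ℂ) (hu : u ≠ 0) (hv : v ≠ 0) (hu' : u' ≠ 0) (hv' : v' ≠ 0)
    (hu'' : u'' ≠ 0) (hv'' : v'' ≠ 0)
    (hreg : (u ^ N)⁻¹ * v' ^ N + v ^ N ≠ 0)
    (hx : u'' ^ N = u ^ N * u' ^ N) (hy : v'' ^ N = (u ^ N)⁻¹ * v' ^ N + v ^ N) :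
    Module.rank ℂ
      (CGsub N (u • opA q N) (v • opB N) (u' • opA q N) (v' • opB N)
        (u'' • opA q N) (v'' • opB N)) = N := by
  have : NeZero N := ⟨by omega⟩
  obtain ⟨hYN, hXY⟩ := Y_facts (u' := u') (v' := v') hN hq hu hv
  have hq1 := hq.pow_eq_one
  have hm : ∃ m : ZMod N, u'' = u * u' * (q ^ 2) ^ m.val := by
    have h1 : (u'' / (u * u')) ^ N = 1 := by
      rw [div_pow, hx, mul_pow, div_self]
      exact mul_ne_zero (pow_ne_zero _ hu) (pow_ne_zero _ hu')
    obtain ⟨i, hi, h⟩ := hq.eq_pow_of_pow_eq_one h1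
    refine ⟨i, ?_⟩
    rw [ZMod.val_natCast_of_lt hi, h]
    field_simp
  obtain ⟨m, hm⟩ := hm
  let b := (Pi.basisFun ℂ (ZMod N)).tensorProduct (Pi.basisFun ℂ (ZMod N))
  set X : Module.End ℂ (CN N ⊗[ℂ] CN N) :=
    TensorProduct.map (u • opA q N) (u' • opA q N) with hX
  have hXb : ∀ p, X (b p) = (u * u' * (q ^ 2) ^ (p.1 + p.2).val) • b p := by
    rintro ⟨i, j⟩
    simp only [b, Module.Basis.tensorProduct_apply, Pi.basisFun_apply, hX, TensorProduct.map_tmul,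
      LinearMap.smul_apply, opA_single, chi_add hq1, TensorProduct.smul_tmul',
      TensorProduct.tmul_smul, smul_smul]
    congr 1; ring
  have hXr : ∀ t p, b.repr (X t) p = (u * u' * (q ^ 2) ^ (p.1 + p.2).val) * b.repr t p := by
    intro t p
    have : (b.coord p) ∘ₗ X = (u * u' * (q ^ 2) ^ (p.1 + p.2).val) • b.coord p := by
      refine b.ext fun p' => ?_
      simp only [LinearMap.comp_apply, hXb, LinearMap.smul_apply, map_smul, Module.Basis.coord_apply,
        Module.Basis.repr_self, Finsupp.single_apply, smul_eq_mul]
      by_cases h : p' = p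
      · subst h; rfl
      · simp [h]
    exact LinearMap.congr_fun this t
  let Φ : (CGsub N (u • opA q N) (v • opB N) (u' • opA q N) (v' • opB N)
        (u'' • opA q N) (v'' • opB N)) →ₗ[ℂ] (ZMod N → ℂ) :=
    LinearMap.pi fun i => (b.coord (i, m - i)) ∘ₗ (LinearMap.applyₗ (Pi.single 0 1 : CN N)) ∘ₗ
      (Submodule.subtype _)
  have hΦ : ∀ f i, Φ f i = b.repr (f.1 (Pi.single 0 1)) (i, m - i) := fun _ _ => rfl
  have hbij : Function.Bijective Φ := by
    constructor
    · have hz : ∀ f : CN N →ₗ[ℂ] (CN N ⊗[ℂ] CN N), f ∘ₗ (u'' • opA q N) = X ∘ₗ f →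
          ∀ i j, j ≠ m - i → b.repr (f (Pi.single 0 1)) (i, j) = 0 := by
        intro f hf1 i j hij
        have h1 := LinearMap.congr_fun hf1 (Pi.single 0 1)
        simp only [LinearMap.comp_apply, LinearMap.smul_apply, opA_single, map_smul, ZMod.val_zero,
          pow_zero, one_smul] at h1
        have h2 := hXr (f (Pi.single 0 1)) (i, j)
        rw [← h1, map_smul, Finsupp.smul_apply, smul_eq_mul] at h2
        by_contra h3
        have h4 := mul_right_cancel₀ h3 h2
        rw [hm] at h4
        have h5 := mul_left_cancel₀ (mul_ne_zero hu hu') h4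
        have h6 := ZMod.val_injective N (hq.pow_inj (ZMod.val_lt _) (ZMod.val_lt _) h5)
        exact hij (by rw [h6]; simp)
      rintro ⟨f, hf1, hf2⟩ ⟨g, hg1, hg2⟩ hfg
      refine Subtype.ext (CG_eq hv'' _ f g hf2 hg2 ?_)
      apply b.repr.injective
      ext ⟨i, j⟩
      by_cases hij : j = m - i
      · subst hij
        exact congrFun hfg i
      · rw [hz f hf1 i j hij, hz g hg1 i j hij]
    · intro c
      let w : CN N ⊗[ℂ] CN N := ∑ i, c i • b (i, m - i)
      have hw : X w = u'' • w := by
        simp only [w, map_sum, map_smul, hXb, Finset.smul_sum]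
        refine Finset.sum_congr rfl fun i _ => ?_
        rw [add_sub_cancel, ← hm, smul_comm]
      rw [← hy] at hYN
      obtain ⟨f, hf1, hf2, hf3⟩ := CG_construct hq1 hv'' X _ hYN hXY w hw
      refine ⟨⟨f, hf1, hf2⟩, funext fun i => ?_⟩
      rw [hΦ]
      simp only [hf3, w, map_sum, map_smul, Module.Basis.repr_self, Finsupp.finsetSum_apply,
        Finsupp.smul_apply, Finsupp.single_apply, Prod.mk.injEq, smul_eq_mul]
      rw [Finset.sum_eq_single i]
      · simp
      · intro j _ hj; simp [hj]
      · simp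
  rw [(LinearEquiv.ofBijective Φ hbij).rank_eq, rank_fun', ZMod.card]

end
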